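/- arXiv:1703.09940 — 4 statements merged into one kernel-verified Lean document; each statement's English description precedes it below -/
import Mathlib

section
/- Spectral theorem for Hermitian quaternion matrices: every n × n quaternion matrix S with S = S† can be diagonalized by a compact symplectic matrix, i.e., there exist K ∈ Sp(n) and real numbers d₁, …, dₙ such that S = K D K†, where D is the diagonal quaternion matrix with (real) diagonal entries d₁, …, dₙ. -/
open scoped Quaternion Matrix

namespace QuaternionMatrix

variable {m n : Type*} [Fintype n]

/-- Multiplication of column vectors by a quaternion matrix, as a real-linear map. -/
def toRealLin (A : Matrix m n ℍ[ℝ]) :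
    PiLp 2 (fun _ : n => ℍ[ℝ]) →ₗ[ℝ] PiLp 2 (fun _ : m => ℍ[ℝ]) where
  toFun x := WithLp.toLp 2 (A *ᵥ x.ofLp)
  map_add' x y := by simp [Matrix.mulVec_add]
  map_smul' c x := by simp [Matrix.mulVec_smul]

@[simp]
theorem ofLp_toRealLin (A : Matrix m n ℍ[ℝ]) (x : PiLp 2 (fun _ : n => ℍ[ℝ])) :
    (toRealLin A x).ofLp = A *ᵥ x.ofLp := rfl

theorem inner_eq_re_dotProduct (x y : PiLp 2 (fun _ : n => ℍ[ℝ])) :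
    inner ℝ x y = (star x.ofLp ⬝ᵥ y.ofLp).re := by
  have h : (star x.ofLp ⬝ᵥ y.ofLp).re = ∑ i, (star (x i) * y i).re :=
    map_sum (QuaternionAlgebra.reₗ (R := ℝ) (-1) 0 (-1)) (fun i => star (x i) * y i) Finset.univ
  rw [h, PiLp.inner_apply]
  refine Finset.sum_congr rfl fun i _ => ?_
  rw [Quaternion.inner_def]
  simp

theorem isSymmetric_toRealLin {S : Matrix n n ℍ[ℝ]} (hS : S.IsHermitian) :
    (toRealLin S).IsSymmetric := fun x y => by
  simp only [inner_eq_re_dotProduct, ofLp_toRealLin, Matrix.star_mulVec, Matrix.dotProduct_mulVec,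
    hS.eq]

/-- The dot product of a vector with itself is a nonnegative real quaternion. -/
theorem star_dotProduct_self (x : PiLp 2 (fun _ : n => ℍ[ℝ])) :
    star x.ofLp ⬝ᵥ x.ofLp = ((‖x‖ ^ 2 : ℝ) : ℍ[ℝ]) := by
  have h : star (star x.ofLp ⬝ᵥ x.ofLp) = star x.ofLp ⬝ᵥ x.ofLp :=
    (Matrix.star_dotProduct _ _).symm
  rw [← real_inner_self_eq_norm_sq, inner_eq_re_dotProduct]
  exact Quaternion.star_eq_self.mp h

theorem finrank_piLp : Module.finrank ℝ (PiLp 2 (fun _ : n => ℍ[ℝ])) = Fintype.card n * 4 := by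
  rw [(WithLp.linearEquiv 2 ℝ (n → ℍ[ℝ])).finrank_eq, Module.finrank_pi_fintype]
  simp [Quaternion.finrank_eq_four]

/-- A Hermitian quaternion matrix that intertwines `Aᴴ` with some `B` has a unit eigenvector
with real eigenvalue in the kernel of `Aᴴ`, provided `A` has fewer columns than rows. -/
theorem exists_unit_eigenvector [Fintype m] {S : Matrix n n ℍ[ℝ]} (hS : S.IsHermitian)
    {A : Matrix n m ℍ[ℝ]} {B : Matrix m m ℍ[ℝ]} (hA : S * A = A * B)
    (hcard : Fintype.card m < Fintype.card n) :
    ∃ (x : n → ℍ[ℝ]) (μ : ℝ), star x ⬝ᵥ x = 1 ∧ Aᴴ *ᵥ x = 0 ∧ S *ᵥ x = μ • x := by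
  let W := LinearMap.ker (toRealLin Aᴴ)
  have hinv : ∀ x ∈ W, toRealLin S x ∈ W := by
    intro x hx
    have hx' : Aᴴ *ᵥ x.ofLp = 0 := congrArg WithLp.ofLp hx
    have hAS : Aᴴ * S = Bᴴ * Aᴴ := by
      simpa [Matrix.conjTranspose_mul, hS.eq] using congrArg Matrix.conjTranspose hA
    refine WithLp.ofLp_injective 2 ?_
    simp only [ofLp_toRealLin, WithLp.ofLp_zero]
    rw [Matrix.mulVec_mulVec, hAS, ← Matrix.mulVec_mulVec, hx', Matrix.mulVec_zero]
  have : Nontrivial W := by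
    rw [Submodule.nontrivial_iff_ne_bot]
    refine LinearMap.ker_ne_bot_of_finrank_lt ?_
    rw [finrank_piLp, finrank_piLp]
    omega
  obtain ⟨μ, hμ⟩ : ∃ μ : ℝ, Module.End.HasEigenvalue ((toRealLin S).restrict hinv) μ :=
    ⟨_, ((isSymmetric_toRealLin hS).restrict_invariant
      hinv).hasEigenvalue_iSup_of_finiteDimensional⟩
  obtain ⟨w, hw⟩ := hμ.exists_hasEigenvector
  have hw0 : ‖(w : PiLp 2 (fun _ : n => ℍ[ℝ]))‖ ≠ 0 := by
    simpa using hw.2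
  set u := ‖(w : PiLp 2 (fun _ : n => ℍ[ℝ]))‖⁻¹ • w with hu
  have hu1 : ‖(u : PiLp 2 (fun _ : n => ℍ[ℝ]))‖ = 1 := by
    simp [hu, norm_smul, hw0]
  have hSu : (toRealLin S).restrict hinv u = μ • u := by
    rw [hu, map_smul, hw.apply_eq_smul, smul_comm]
  refine ⟨(u : PiLp 2 (fun _ : n => ℍ[ℝ])).ofLp, μ, ?_, congrArg WithLp.ofLp u.2,
    congrArg (fun z : W => (z : PiLp 2 (fun _ : n => ℍ[ℝ])).ofLp) hSu⟩
  rw [star_dotProduct_self, hu1]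
  simp

/-- A matrix whose columns are eigenvectors with real eigenvalues intertwines the given matrix with
the diagonal matrix of the eigenvalues. -/
theorem mul_eq_mul_diagonal [Fintype m] [DecidableEq m] {S : Matrix n n ℍ[ℝ]} {v : m → n → ℍ[ℝ]}
    {d : m → ℝ} (h : ∀ i, S *ᵥ v i = d i • v i) :
    S * (Matrix.of v)ᵀ = (Matrix.of v)ᵀ * Matrix.diagonal fun i => ((d i : ℝ) : ℍ[ℝ]) := by
  ext1 a i
  rw [Matrix.mul_diagonal, ← Quaternion.coe_commutes, Quaternion.coe_mul_eq_smul]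
  exact congrFun (h i) a

/-- A Hermitian quaternion matrix of size `n` has, for each `k ≤ n`, an orthonormal family of `k`
eigenvectors with real eigenvalues. -/
theorem exists_orthonormal_eigenvectors {S : Matrix n n ℍ[ℝ]} (hS : S.IsHermitian) (k : ℕ)
    (hk : k ≤ Fintype.card n) :
    ∃ (v : Fin k → n → ℍ[ℝ]) (d : Fin k → ℝ),
      (∀ i j, star (v i) ⬝ᵥ v j = if i = j then 1 else 0) ∧ ∀ i, S *ᵥ v i = d i • v i := by
  induction k with
  | zero => exact ⟨Fin.elim0, Fin.elim0, fun i => i.elim0, fun i => i.elim0⟩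
  | succ k ih =>
    obtain ⟨v, d, hv, hd⟩ := ih (by omega)
    obtain ⟨x, μ, hx1, hx0, hxS⟩ :=
      exists_unit_eigenvector hS (mul_eq_mul_diagonal hd) (by simpa using hk)
    have hvx : ∀ i, star (v i) ⬝ᵥ x = 0 := fun i => congrFun hx0 i
    have hxv : ∀ i, star x ⬝ᵥ v i = 0 := fun i => by
      rw [Matrix.star_dotProduct, hvx, star_zero]
    refine ⟨Fin.snoc v x, Fin.snoc d μ, fun i j => ?_, fun i => ?_⟩
    · induction i using Fin.lastCases <;> induction j using Fin.lastCases <;>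
        simp [hx1, hvx, hxv, hv, Fin.castSucc_ne_last, (Fin.castSucc_ne_last _).symm]
    · induction i using Fin.lastCases <;> simp [hd, hxS]

end QuaternionMatrix

/-- Spectral theorem for Hermitian quaternion matrices: every `S` with `S = Sᴴ` can be
diagonalized by a compact symplectic matrix `K` (i.e. `K Kᴴ = Kᴴ K = 1`), with real
diagonal entries `d₁, …, dₙ`. -/
theorem hermitian_quaternion_spectral_theorem (n : ℕ) (S : Matrix (Fin n) (Fin n) ℍ[ℝ])
    (hS : S = Sᴴ) :
    ∃ (K : Matrix (Fin n) (Fin n) ℍ[ℝ]) (d : Fin n → ℝ),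
      K * Kᴴ = 1 ∧ Kᴴ * K = 1 ∧
      S = K * Matrix.diagonal (fun i => ((d i : ℝ) : ℍ[ℝ])) * Kᴴ := by
  obtain ⟨v, d, hv, hd⟩ :=
    QuaternionMatrix.exists_orthonormal_eigenvectors (S := S) hS.symm n (by simp)
  let K : Matrix (Fin n) (Fin n) ℍ[ℝ] := (Matrix.of v)ᵀ
  have hK : Kᴴ * K = 1 := by
    ext1 i j
    rw [Matrix.one_apply]
    exact hv i j
  have hK' : K * Kᴴ = 1 := mul_eq_one_comm.mp hK
  refine ⟨K, d, hK', hK, ?_⟩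
  rw [← QuaternionMatrix.mul_eq_mul_diagonal hd, Matrix.mul_assoc, hK', Matrix.mul_one]
end

section
/- Proposition 1(i) (well-definedness of the metric): let S be an n × n positive-definite quaternion matrix and let u, v be n × n quaternion matrices with u = u† and v = v†. If A and B are invertible quaternion matrices with A A† = B B† = S, then Re tr( (A⁻¹ u (A⁻¹)†) (A⁻¹ v (A⁻¹)†)† ) = Re tr( (B⁻¹ u (B⁻¹)†) (B⁻¹ v (B⁻¹)†)† ). Hence the scalar product (u, v)_S = ⟨ A⁻¹ u (A⁻¹)† | A⁻¹ v (A⁻¹)† ⟩ is independent of the choice of A with A A† = S. -/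
open scoped Quaternion Matrix

theorem Quaternion.re_finset_sum {ι : Type*} (s : Finset ι) (f : ι → ℍ[ℝ]) :
    (∑ i ∈ s, f i).re = ∑ i ∈ s, (f i).re :=
  map_sum (AddMonoidHom.mk' (fun q : ℍ[ℝ] => q.re) Quaternion.re_add) f s

/-- The real part of the trace is invariant under commuting two quaternion matrices, although the
trace itself is not. -/
theorem Quaternion.re_trace_mul_comm {m n : Type*} [Fintype m] [Fintype n]
    (X : Matrix m n ℍ[ℝ]) (Y : Matrix n m ℍ[ℝ]) :
    (X * Y).trace.re = (Y * X).trace.re := by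
  simp only [Matrix.trace, Matrix.diag_apply, Matrix.mul_apply, Quaternion.re_finset_sum]
  rw [Finset.sum_comm]
  refine Finset.sum_congr rfl fun j _ => Finset.sum_congr rfl fun i _ => ?_
  rw [Quaternion.re_mul, Quaternion.re_mul]
  ring

/-- A one-sided factorization `S = A Aᴴ` determines `(A⁻¹)ᴴ A⁻¹`, which is the inverse of `S`. -/
theorem conjTranspose_invOf_mul_invOf_eq {R ι : Type*} [Semiring R] [StarRing R] [Fintype ι]
    [DecidableEq ι] {A B : Matrix ι ι R} [Invertible A] [Invertible B]
    (h : A * Aᴴ = B * Bᴴ) : (⅟A)ᴴ * ⅟A = (⅟B)ᴴ * ⅟B := by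
  refine left_inv_eq_right_inv (a := A * Aᴴ) ?_ ?_
  · rw [Matrix.mul_assoc, ← Matrix.mul_assoc (⅟A), invOf_mul_self, Matrix.one_mul,
      ← Matrix.conjTranspose_mul, mul_invOf_self, Matrix.conjTranspose_one]
  · rw [h, Matrix.mul_assoc, ← Matrix.mul_assoc Bᴴ, ← Matrix.conjTranspose_mul,
      invOf_mul_self, Matrix.conjTranspose_one, Matrix.one_mul, mul_invOf_self]

/-- The scalar product of `C u Cᴴ` and `C v Cᴴ` depends on `C` only through `Cᴴ C`. -/
theorem Quaternion.re_trace_congruence_mul {m n : Type*} [Fintype m] [Fintype n]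
    (C : Matrix m n ℍ[ℝ]) (u v : Matrix n n ℍ[ℝ]) :
    ((C * u * Cᴴ) * (C * v * Cᴴ)ᴴ).trace.re
      = (u * (Cᴴ * C) * (vᴴ * (Cᴴ * C))).trace.re := by
  rw [Matrix.conjTranspose_mul, Matrix.conjTranspose_mul, Matrix.conjTranspose_conjTranspose,
    Matrix.mul_assoc C, Matrix.mul_assoc C, Quaternion.re_trace_mul_comm]
  simp only [Matrix.mul_assoc]

/-- Proposition 1(i): well-definedness of the metric. If `A Aᴴ = B Bᴴ = S` with `A`, `B`
invertible, and `u = uᴴ`, `v = vᴴ`, then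
`Re tr((A⁻¹ u (A⁻¹)ᴴ)(A⁻¹ v (A⁻¹)ᴴ)ᴴ) = Re tr((B⁻¹ u (B⁻¹)ᴴ)(B⁻¹ v (B⁻¹)ᴴ)ᴴ)`,
so the scalar product `(u,v)_S` does not depend on the choice of `A` with `A Aᴴ = S`. -/
theorem metric_well_defined (n : ℕ) (S u v A B : Matrix (Fin n) (Fin n) ℍ[ℝ])
    [Invertible A] [Invertible B]
    (hA : A * Aᴴ = S) (hB : B * Bᴴ = S)
    (hu : u = uᴴ) (hv : v = vᴴ) :
    ((⅟A * u * (⅟A)ᴴ) * (⅟A * v * (⅟A)ᴴ)ᴴ).trace.re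
      = ((⅟B * u * (⅟B)ᴴ) * (⅟B * v * (⅟B)ᴴ)ᴴ).trace.re := by
  rw [Quaternion.re_trace_congruence_mul, Quaternion.re_trace_congruence_mul,
    conjTranspose_invOf_mul_invOf_eq (hA.trans hB.symm)]
end

section
/- Polar decomposition of invertible quaternion matrices: every invertible n × n quaternion matrix Z can be written as Z = K P where K ∈ Sp(n) (i.e., K K† = I) and P is an n × n positive-definite quaternion matrix. -/
open scoped Quaternion Matrix

/-- `P` is a positive-definite quaternion matrix. -/
def QuatPosDef {n : ℕ} (P : Matrix (Fin n) (Fin n) ℍ[ℝ]) : Prop :=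
  P = Pᴴ ∧ ∀ x : Fin n → ℍ[ℝ], x ≠ 0 → 0 < (∑ i, ∑ j, star (x i) * P i j * x j).re

namespace QuaternionMatrix

theorem conjTranspose_real_smul {m n : Type*} (r : ℝ) (X : Matrix m n ℍ[ℝ]) :
    (r • X)ᴴ = r • Xᴴ := by
  ext1 i j
  exact Quaternion.star_smul r (X j i)

variable {m n : Type*} [Fintype m] [Fintype n]

theorem re_sum {ι : Type*} (s : Finset ι) (f : ι → ℍ[ℝ]) :
    (∑ i ∈ s, f i).re = ∑ i ∈ s, (f i).re :=
  map_sum (AddMonoidHom.mk' (fun q : ℍ[ℝ] => q.re) fun _ _ => rfl) f s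

theorem re_star_dotProduct_self (x : n → ℍ[ℝ]) :
    (star x ⬝ᵥ x).re = ∑ i, Quaternion.normSq (x i) := by
  simp only [dotProduct, re_sum, Pi.star_apply, Quaternion.star_mul_self, Quaternion.re_coe]

theorem re_star_dotProduct_self_pos {x : n → ℍ[ℝ]} (hx : x ≠ 0) : 0 < (star x ⬝ᵥ x).re := by
  obtain ⟨i, hi⟩ := Function.ne_iff.mp hx
  rw [re_star_dotProduct_self]
  exact Finset.sum_pos' (fun _ _ => Quaternion.normSq_nonneg)
    ⟨i, Finset.mem_univ i, lt_of_le_of_ne Quaternion.normSq_nonneg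
      (Ne.symm (Quaternion.normSq_ne_zero.mpr hi))⟩

theorem re_trace_conjTranspose_mul_self (X : Matrix m n ℍ[ℝ]) :
    (Xᴴ * X).trace.re = ∑ j, ∑ i, Quaternion.normSq (X i j) := by
  simp only [Matrix.trace, re_sum, Matrix.diag_apply]
  exact Finset.sum_congr rfl fun j _ => re_star_dotProduct_self (X.col j)

theorem re_trace_conjTranspose_mul_self_nonneg (X : Matrix m n ℍ[ℝ]) :
    0 ≤ (Xᴴ * X).trace.re := by
  rw [re_trace_conjTranspose_mul_self]
  exact Finset.sum_nonneg fun _ _ => Finset.sum_nonneg fun _ _ => Quaternion.normSq_nonneg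

theorem eq_zero_of_re_trace_conjTranspose_mul_self_eq_zero {X : Matrix m n ℍ[ℝ]}
    (h : (Xᴴ * X).trace.re = 0) : X = 0 := by
  rw [re_trace_conjTranspose_mul_self, Finset.sum_eq_zero_iff_of_nonneg fun _ _ =>
    Finset.sum_nonneg fun _ _ => Quaternion.normSq_nonneg] at h
  ext1 i j
  have hj := h j (Finset.mem_univ j)
  rw [Finset.sum_eq_zero_iff_of_nonneg fun _ _ => Quaternion.normSq_nonneg] at hj
  exact Quaternion.normSq_eq_zero.mp (hj i (Finset.mem_univ i))

/-- The Frobenius inner product `Re tr (Xᴴ Y)` on quaternion matrices. -/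
@[reducible] noncomputable def frobeniusCore (m n : Type*) [Fintype m] [Fintype n] :
    InnerProductSpace.Core ℝ (Matrix m n ℍ[ℝ]) where
  inner X Y := (Xᴴ * Y).trace.re
  conj_inner_symm X Y := by
    change (Yᴴ * X).trace.re = (Xᴴ * Y).trace.re
    rw [← Quaternion.re_star, ← Matrix.trace_conjTranspose, Matrix.conjTranspose_mul,
      Matrix.conjTranspose_conjTranspose]
  re_inner_nonneg X := re_trace_conjTranspose_mul_self_nonneg X
  add_left X Y W := by
    simp [Matrix.conjTranspose_add, Matrix.add_mul, Matrix.trace_add]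
  smul_left X Y r := by
    simp [conjTranspose_real_smul, Matrix.trace_smul]
  definite X h := eq_zero_of_re_trace_conjTranspose_mul_self_eq_zero h

variable [DecidableEq n]

/-- A Gram matrix `Zᴴ Z` has Hermitian roots of every positive order, obtained as real polynomials
in `Zᴴ Z`. -/
theorem exists_isHermitian_pow_eq (Z : Matrix m n ℍ[ℝ]) {k : ℕ} (hk : k ≠ 0) :
    ∃ R : Matrix n n ℍ[ℝ], R.IsHermitian ∧ R ^ k = Zᴴ * Z := by
  let _ : NormedAddCommGroup (Matrix n n ℍ[ℝ]) := (frobeniusCore n n).toNormedAddCommGroup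
  let _ : InnerProductSpace ℝ (Matrix n n ℍ[ℝ]) := InnerProductSpace.ofCore (frobeniusCore n n).toCore
  set A := Zᴴ * Z with hA
  have hAH : Aᴴ = A := Matrix.isHermitian_conjTranspose_mul_self Z
  set T : Module.End ℝ (Matrix n n ℍ[ℝ]) := Algebra.lmul ℝ _ A with hT
  have hTsymm : T.IsSymmetric := fun X Y => by
    change ((A * X)ᴴ * Y).trace.re = (Xᴴ * (A * Y)).trace.re
    rw [Matrix.conjTranspose_mul, hAH, Matrix.mul_assoc]
  set lam := hTsymm.eigenvalues rfl
  set b := hTsymm.eigenvectorBasis rfl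
  have hlam : ∀ i, 0 ≤ lam i := fun i => by
    have hb : A * b i = lam i • b i := hTsymm.apply_eigenvectorBasis rfl i
    have hne : b i ≠ 0 := b.orthonormal.ne_zero i
    have hpos : 0 < ((b i)ᴴ * b i).trace.re :=
      lt_of_le_of_ne (re_trace_conjTranspose_mul_self_nonneg _)
        fun h => hne (eq_zero_of_re_trace_conjTranspose_mul_self_eq_zero h.symm)
    have h0 := re_trace_conjTranspose_mul_self_nonneg (Z * b i)
    rw [Matrix.conjTranspose_mul, Matrix.mul_assoc, ← Matrix.mul_assoc Zᴴ, ← hA, hb,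
      Matrix.mul_smul, Matrix.trace_smul, Quaternion.re_smul, smul_eq_mul] at h0
    exact nonneg_of_mul_nonneg_left h0 hpos
  set s := Finset.univ.image lam
  set p : Polynomial ℝ := Lagrange.interpolate s id fun t => t ^ ((k : ℝ)⁻¹)
  have hp : ∀ i, (p ^ k).eval (lam i) = lam i := fun i => by
    have h := Lagrange.eval_interpolate_at_node (fun t : ℝ => t ^ ((k : ℝ)⁻¹))
      (s := s) (v := id) Function.injective_id.injOn
      (Finset.mem_image_of_mem lam (Finset.mem_univ i))
    rw [Polynomial.eval_pow]
    exact (congrArg (· ^ k) h).trans (Real.rpow_inv_natCast_pow (hlam i) hk)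
  refine ⟨Polynomial.aeval A p, ?_, ?_⟩
  · have : Polynomial.aeval (star A) p = star (Polynomial.aeval A p) := by
      simp only [Polynomial.aeval_eq_sum_range, star_sum, Matrix.star_eq_conjTranspose,
        conjTranspose_real_smul, Matrix.conjTranspose_pow]
    rw [Matrix.star_eq_conjTranspose, hAH] at this
    exact this.symm
  · rw [← map_pow]
    have key : Polynomial.aeval T (p ^ k) = T := b.toBasis.ext fun i => by
      rw [OrthonormalBasis.coe_toBasis, Module.End.aeval_apply_of_hasEigenvector
        (hTsymm.hasEigenvector_eigenvectorBasis rfl i)]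
      exact (congrArg (· • b i) (hp i)).trans (hTsymm.apply_eigenvectorBasis rfl i).symm
    rw [hT, Polynomial.aeval_algHom_apply] at key
    exact Algebra.lmul_injective key

theorem re_star_dotProduct_sq_mulVec_pos {R : Matrix n n ℍ[ℝ]} (hR : R.IsHermitian)
    (hu : IsUnit R) {x : n → ℍ[ℝ]} (hx : x ≠ 0) : 0 < (star x ⬝ᵥ (R ^ 2) *ᵥ x).re := by
  have hRx : R *ᵥ x ≠ 0 := fun h => hx <| by
    obtain ⟨S, hS⟩ := hu.exists_left_inv
    rw [← Matrix.one_mulVec x, ← hS, ← Matrix.mulVec_mulVec, h, Matrix.mulVec_zero]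
  have h := re_star_dotProduct_self_pos hRx
  rwa [Matrix.star_mulVec, hR.eq, ← Matrix.dotProduct_mulVec, Matrix.mulVec_mulVec, ← sq] at h

end QuaternionMatrix

/-- Polar decomposition: every invertible quaternion matrix `Z` can be written as `Z = K P`
with `K ∈ Sp(n)` (i.e. `K Kᴴ = Kᴴ K = 1`) and `P` positive-definite. -/
theorem quaternion_polar_decomposition (n : ℕ) (Z : Matrix (Fin n) (Fin n) ℍ[ℝ])
    (hZ : IsUnit Z) :
    ∃ K P : Matrix (Fin n) (Fin n) ℍ[ℝ],
      K * Kᴴ = 1 ∧ Kᴴ * K = 1 ∧ QuatPosDef P ∧ Z = K * P := by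
  obtain ⟨R, hR, hR4⟩ := QuaternionMatrix.exists_isHermitian_pow_eq Z four_ne_zero
  have hRu : IsUnit R := by
    rw [← isUnit_pow_iff four_ne_zero, hR4]
    exact hZ.star.mul hZ
  obtain ⟨U, hU⟩ := hRu.pow 2
  have hPH : (R ^ 2)ᴴ = R ^ 2 := hR.pow 2
  set Q : Matrix (Fin n) (Fin n) ℍ[ℝ] := ↑U⁻¹
  have hQP : Q * R ^ 2 = 1 := by rw [← hU]; exact U.inv_mul
  have hPQ : R ^ 2 * Q = 1 := by rw [← hU]; exact U.mul_inv
  have hQHP : Qᴴ * R ^ 2 = 1 := by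
    rw [← hPH, ← Matrix.conjTranspose_mul, hPQ, Matrix.conjTranspose_one]
  have hKK : (Z * Q)ᴴ * (Z * Q) = 1 := by
    calc (Z * Q)ᴴ * (Z * Q) = Qᴴ * (Zᴴ * Z) * Q := by
          simp only [Matrix.conjTranspose_mul, Matrix.mul_assoc]
      _ = (Qᴴ * R ^ 2) * (R ^ 2 * Q) := by
          rw [← hR4, show R ^ 4 = R ^ 2 * R ^ 2 from pow_add R 2 2]
          simp only [Matrix.mul_assoc]
      _ = 1 := by rw [hQHP, hPQ, one_mul]
  have hKu : IsUnit (Z * Q) := hZ.mul U⁻¹.isUnit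
  refine ⟨Z * Q, R ^ 2, ?_, hKK, ⟨hPH.symm, fun x hx => ?_⟩, ?_⟩
  · obtain ⟨S, hS⟩ := hKu.exists_right_inv
    rwa [left_inv_eq_right_inv hKK hS]
  · have h := QuaternionMatrix.re_star_dotProduct_sq_mulVec_pos hR hRu hx
    simpa only [dotProduct, Matrix.mulVec, Finset.mul_sum, mul_assoc, Pi.star_apply] using h
  · rw [Matrix.mul_assoc, hQP, Matrix.mul_one]
end

section
/- Convergence of the normalising constant: for every σ > 0 and every n ≥ 1, the function r = (r₁, …, rₙ) ↦ exp( −(1/(2σ²)) Σᵢ rᵢ² ) · Π_{i<j} sinh⁴( |rᵢ − rⱼ| / 2 ) is Lebesgue-integrable on ℝⁿ; hence the integral Z(σ) = Const · ∫_{ℝⁿ} exp( −(1/(2σ²)) Σᵢ rᵢ² ) Π_{i<j} sinh⁴( |rᵢ − rⱼ| / 2 ) dr₁⋯drₙ defining the normalising constant of the Riemannian Gaussian distribution on 𝒬ₙ is finite. -/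
open MeasureTheory

theorem Real.sinh_le_exp (x : ℝ) : Real.sinh x ≤ Real.exp x := by
  rw [Real.sinh_eq]
  linarith [Real.exp_pos x, Real.exp_pos (-x)]

theorem integrable_exp_neg_mul_sum_sq {ι : Type*} [Fintype ι] {b : ℝ} (hb : 0 < b) :
    Integrable (fun r : ι → ℝ => Real.exp (-b * ∑ i, r i ^ 2)) := by
  simpa only [Finset.mul_sum, Real.exp_sum] using!
    Integrable.fintype_prod (fun _ : ι => integrable_exp_neg_mul_sq hb)

theorem integrable_exp_neg_mul_sum_sq_add_mul_sum_abs {ι : Type*} [Fintype ι] {b : ℝ}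
    (hb : 0 < b) (c : ℝ) :
    Integrable (fun r : ι → ℝ => Real.exp (-b * ∑ i, r i ^ 2 + c * ∑ i, |r i|)) := by
  refine ((integrable_exp_neg_mul_sum_sq (ι := ι) (half_pos hb)).mul_const
    (Real.exp (∑ _i : ι, c ^ 2 / (2 * b)))).mono'
    (by fun_prop) (.of_forall fun r => ?_)
  rw [Real.norm_eq_abs, Real.abs_exp, ← Real.exp_add, Real.exp_le_exp]
  simp only [Finset.mul_sum, ← Finset.sum_add_distrib]
  refine Finset.sum_le_sum fun i _ => ?_
  have h : -(b / 2) * r i ^ 2 + c ^ 2 / (2 * b) - (-b * r i ^ 2 + c * |r i|) =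
      (b * |r i| - c) ^ 2 / (2 * b) := by
    rw [← sq_abs (r i)]
    field_simp
    ring
  have : 0 ≤ (b * |r i| - c) ^ 2 / (2 * b) := by positivity
  linarith

theorem sinh_half_abs_sub_pow_four_le {ι : Type*} [Fintype ι] (r : ι → ℝ) (i j : ι) :
    Real.sinh (|r i - r j| / 2) ^ 4 ≤ Real.exp (4 * ∑ k, |r k|) := by
  have hle (k : ι) : |r k| ≤ ∑ k, |r k| :=
    Finset.single_le_sum (f := fun k => |r k|) (fun _ _ => abs_nonneg _) (Finset.mem_univ k)
  calc Real.sinh (|r i - r j| / 2) ^ 4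
      ≤ Real.exp (|r i - r j| / 2) ^ 4 :=
        pow_le_pow_left₀ (Real.sinh_nonneg_iff.2 (by positivity)) (Real.sinh_le_exp _) 4
    _ = Real.exp (2 * |r i - r j|) := by
        rw [← Real.exp_nat_mul]
        push_cast
        ring_nf
    _ ≤ Real.exp (4 * ∑ k, |r k|) :=
        Real.exp_le_exp.2 (by linarith [abs_sub (r i) (r j), hle i, hle j])

/-- Convergence of the normalising constant: for every `σ > 0` and `n ≥ 1`, the function
`r ↦ exp(−(1/(2σ²)) Σᵢ rᵢ²) · Π_{i<j} sinh⁴(|rᵢ − rⱼ|/2)` is Lebesgue-integrable on `ℝⁿ`,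
so the integral `Z(σ)` is finite. -/
theorem normalising_constant_integrable (n : ℕ) (hn : 1 ≤ n) (σ : ℝ) (hσ : 0 < σ) :
    Integrable
      (fun r : Fin n → ℝ =>
        Real.exp (-(1 / (2 * σ ^ 2)) * ∑ i, r i ^ 2) *
          ∏ p ∈ Finset.univ.filter (fun p : Fin n × Fin n => p.1 < p.2),
            Real.sinh (|r p.1 - r p.2| / 2) ^ 4)
      (volume : Measure (Fin n → ℝ)) := by
  set P := Finset.univ.filter (fun p : Fin n × Fin n => p.1 < p.2)
  refine (integrable_exp_neg_mul_sum_sq_add_mul_sum_abs (ι := Fin n)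
    (b := 1 / (2 * σ ^ 2)) (by positivity) (P.card * 4)).mono' ?_ (.of_forall fun r => ?_)
  · exact Continuous.aestronglyMeasurable (by fun_prop)
  · have hnonneg (p : Fin n × Fin n) : 0 ≤ Real.sinh (|r p.1 - r p.2| / 2) ^ 4 := by
      positivity
    rw [Real.norm_of_nonneg (mul_nonneg (Real.exp_nonneg _)
      (Finset.prod_nonneg fun p _ => hnonneg p)), Real.exp_add]
    gcongr
    calc ∏ p ∈ P, Real.sinh (|r p.1 - r p.2| / 2) ^ 4
        ≤ ∏ _p ∈ P, Real.exp (4 * ∑ k, |r k|) :=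
          Finset.prod_le_prod (fun p _ => hnonneg p)
            fun p _ => sinh_half_abs_sub_pow_four_le r p.1 p.2
      _ = Real.exp (P.card * 4 * ∑ k, |r k|) := by
          rw [Finset.prod_const, ← Real.exp_nat_mul, mul_assoc]
end
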